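/- arXiv:1005.5581 — 5 statements merged into one kernel-verified Lean document; each statement's English description precedes it below -/
import Mathlib

section
/- Suppose the Tsybakov noise condition holds: there are constants C₀ > 0 and λ > 0 such that μ({x : |φ(x) − 1/2| ≤ t}) ≤ C₀ t^λ for all 0 < t ≤ 1/2. Then for every measurable set S ⊆ X, d(S, S*) ≥ C₁ · (d_Δ(S, S*))^k, where k = (1 + λ)/λ and C₁ = 2 C₀^{−1/λ} λ (λ + 1)^{−1 − 1/λ}. -/
open MeasureTheory Set
open scoped symmDiff

/-- Markov-type bound: off the set where `|φ - 1/2| ≤ t`, the integrand `|2φ - 1|` is at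
least `2t`. -/
lemma two_mul_mul_measureReal_sub_le_setIntegral
    {X : Type*} [MeasurableSpace X] {μ : Measure X} [IsFiniteMeasure μ]
    {φ : X → ℝ} (hφ : Measurable φ) (hint : Integrable (fun x ↦ |2 * φ x - 1|) μ)
    {t : ℝ} (ht : 0 ≤ t) {D : Set X} (hD : MeasurableSet D) :
    2 * t * (μ.real D - μ.real {x | |φ x - 1/2| ≤ t}) ≤ ∫ x in D, |2 * φ x - 1| ∂μ := by
  set A : Set X := {x | |φ x - 1/2| ≤ t} with hA
  have hAm : MeasurableSet A := measurableSet_le (by fun_prop) measurable_const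
  calc 2 * t * (μ.real D - μ.real A)
      ≤ 2 * t * μ.real (D \ A) := by
        gcongr
        exact le_measureReal_sdiff
    _ ≤ ∫ x in D \ A, |2 * φ x - 1| ∂μ := by
        refine setIntegral_ge_of_const_le_real (hD.diff hAm) (measure_ne_top _ _) ?_
          hint.integrableOn
        intro x hx
        have hxA : t < |φ x - 1/2| := not_le.mp hx.2
        have : |2 * φ x - 1| = 2 * |φ x - 1/2| := by
          rw [← abs_two, ← abs_mul, abs_two]
          ring_nf
        linarith
    _ ≤ ∫ x in D, |2 * φ x - 1| ∂μ :=
        setIntegral_mono_set hint.integrableOn (ae_of_all _ fun x ↦ abs_nonneg _)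
          sdiff_subset.eventuallyLE

/-- Under the Tsybakov noise condition
`μ({x : |φ(x) − 1/2| ≤ t}) ≤ C₀ t^λ` for all `0 < t ≤ 1/2`, every measurable set
`S ⊆ X` satisfies `d(S, S*) ≥ C₁ · (d_Δ(S, S*))^k`, where `k = (1 + λ)/λ` and
`C₁ = 2 C₀^{−1/λ} λ (λ + 1)^{−1 − 1/λ}`. -/
theorem tsybakov_distance_lower_bound
    {X : Type*} [MeasurableSpace X] (μ : Measure X) [IsProbabilityMeasure μ]
    (φ : X → ℝ) (hφ : Measurable φ) (hφ0 : ∀ x, 0 ≤ φ x) (hφ1 : ∀ x, φ x ≤ 1)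
    (C₀ lam : ℝ) (hC₀ : 0 < C₀) (hlam : 0 < lam)
    (htsybakov : ∀ t : ℝ, 0 < t → t ≤ 1/2 →
      (μ {x | |φ x - 1/2| ≤ t}).toReal ≤ C₀ * t ^ lam)
    (S : Set X) (hS : MeasurableSet S) :
    (∫ x in S ∆ {x | φ x ≥ 1/2}, |2 * φ x - 1| ∂μ)
      ≥ (2 * C₀ ^ (-1/lam) * lam * (lam + 1) ^ (-1 - 1/lam)) *
        ((μ (S ∆ {x | φ x ≥ 1/2})).toReal) ^ ((1 + lam)/lam) := by
  set D : Set X := S ∆ {x | φ x ≥ 1/2} with hDdef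
  have hD : MeasurableSet D := hS.symmDiff (measurableSet_le measurable_const hφ)
  have hint : Integrable (fun x ↦ |2 * φ x - 1|) μ := by
    refine Integrable.of_bound (C := 1) (by fun_prop) (ae_of_all _ fun x ↦ ?_)
    rw [Real.norm_eq_abs, abs_abs, abs_le]
    constructor <;> linarith [hφ0 x, hφ1 x]
  change _ ≤ _
  change _ * μ.real D ^ _ ≤ _
  have hm1 : μ.real D ≤ 1 := measureReal_le_one
  rcases (measureReal_nonneg (μ := μ) (s := D)).eq_or_lt with hm | hm
  · rw [← hm, Real.zero_rpow (by positivity), mul_zero]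
    exact integral_nonneg fun x ↦ abs_nonneg _
  have hC₀_ge : 1 ≤ C₀ * (1/2 : ℝ) ^ lam := by
    have huniv : {x | |φ x - 1/2| ≤ 1/2} = univ := by
      refine eq_univ_of_forall fun x ↦ ?_
      rw [mem_ofPred_eq, abs_le]
      constructor <;> linarith [hφ0 x, hφ1 x]
    have h := htsybakov (1/2) (by norm_num) le_rfl
    rwa [huniv, measure_univ, ENNReal.toReal_one] at h
  set m := μ.real D with hmdef
  set t : ℝ := (m / (C₀ * (lam + 1))) ^ (1 / lam) with htdef
  have ht : 0 < t := by positivity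
  have htpow : t ^ lam = m / (C₀ * (lam + 1)) := by
    rw [htdef, ← Real.rpow_mul (by positivity), one_div_mul_cancel hlam.ne', Real.rpow_one]
  have ht_le : t ≤ 1/2 := by
    rw [← Real.rpow_le_rpow_iff ht.le (by norm_num) hlam, htpow, div_le_iff₀ (by positivity)]
    nlinarith
  have hA : μ.real {x | |φ x - 1/2| ≤ t} ≤ m / (lam + 1) := by
    refine (htsybakov t ht ht_le).trans_eq ?_
    rw [htpow]
    field_simp
  have hval : 2 * C₀ ^ (-1/lam) * lam * (lam + 1) ^ (-1 - 1/lam) * m ^ ((1 + lam)/lam)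
      = 2 * t * (m - m / (lam + 1)) := by
    have hl : 0 < lam + 1 := by positivity
    have hexp : (1 + lam)/lam = 1/lam + 1 := by field_simp
    rw [htdef, Real.div_rpow hm.le (by positivity), Real.mul_rpow hC₀.le hl.le, hexp,
      Real.rpow_add hm, Real.rpow_one, neg_div, Real.rpow_neg hC₀.le, sub_eq_add_neg (-1 : ℝ),
      Real.rpow_add hl, Real.rpow_neg hl.le, Real.rpow_neg hl.le, Real.rpow_one]
    field_simp
    ring
  rw [hval]
  refine le_trans ?_ (two_mul_mul_measureReal_sub_le_setIntegral hφ hint ht.le hD)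
  gcongr
end

section
/- Let S₁, S₂, S₁', S₂', S* ⊆ X be measurable, let Q := S₁ Δ S₂ be the contention region, and assume the non-degradation condition μ((S_v' Δ S*) ∖ Q) ≤ μ((S_v Δ S*) ∖ Q) for v = 1, 2. Let D := (S₁' Δ S₂') ∖ Q, assume μ(D) > 0, and set τ := μ(D ∖ S*)/μ(D) − 1/2. Then μ(((S₁' ∩ S₂') Δ S*) ∖ Q) ≤ μ(((S₁ ∩ S₂) Δ S*) ∖ Q) − τ · μ(D), and μ(((S₁' ∪ S₂') Δ S*) ∖ Q) ≤ μ(((S₁ ∪ S₂) Δ S*) ∖ Q) + τ · μ(D). -/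
open MeasureTheory Set
open scoped symmDiff

namespace MeasureTheory

variable {X : Type*} [MeasurableSpace X] {ν : Measure X} [IsFiniteMeasure ν] {A B T : Set X}

/-- Enlarging `A` to `B` changes the error against `T` by the gain on `(B \ A) \ T` and the
loss on `(B \ A) ∩ T`. -/
theorem measureReal_symmDiff_add_diff_of_subset (hA : MeasurableSet A) (hB : MeasurableSet B)
    (hT : MeasurableSet T) (h : A ⊆ B) :
    ν.real (A ∆ T) + ν.real ((B \ A) \ T) = ν.real (B ∆ T) + ν.real ((B \ A) ∩ T) := by
  rw [← measureReal_union _ ((hB.diff hA).diff hT), ← measureReal_union _ ((hB.diff hA).inter hT)]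
  · congr 1
    ext x
    have := @h x
    simp only [mem_union, mem_symmDiff, mem_sdiff, mem_inter_iff]
    tauto
  · rw [Set.disjoint_left]
    intro x
    simp only [mem_symmDiff, mem_sdiff, mem_inter_iff]
    tauto
  · rw [Set.disjoint_left]
    intro x
    simp only [mem_symmDiff, mem_sdiff]
    tauto

theorem measureReal_symmDiff_inter_add (hA : MeasurableSet A) (hB : MeasurableSet B) :
    ν.real ((A ∆ B) ∩ T) = ν.real ((A \ B) ∩ T) + ν.real ((B \ A) ∩ T) := by
  simpa only [measureReal_restrict_apply (hA.symmDiff hB), measureReal_restrict_apply (hA.diff hB),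
    measureReal_restrict_apply (hB.diff hA)] using
    measureReal_symmDiff_eq (μ := ν.restrict T) hA hB

/-- The error of an intersection against `T`, in terms of the errors of the two sets. -/
theorem two_mul_measureReal_inter_symmDiff (hA : MeasurableSet A) (hB : MeasurableSet B)
    (hT : MeasurableSet T) :
    2 * ν.real ((A ∩ B) ∆ T) + ν.real ((A ∆ B) \ T)
      = ν.real (A ∆ T) + ν.real (B ∆ T) + ν.real ((A ∆ B) ∩ T) := by
  have h₁ := measureReal_symmDiff_add_diff_of_subset (ν := ν) (hA.inter hB) hA hT inter_subset_left
  have h₂ := measureReal_symmDiff_add_diff_of_subset (ν := ν) (hA.inter hB) hB hT inter_subset_right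
  rw [sdiff_self_inter] at h₁
  rw [sdiff_inter_self_eq_sdiff] at h₂
  have h₃ := measureReal_symmDiff_inter_add (ν := ν) (T := T) hA hB
  have h₄ := measureReal_symmDiff_inter_add (ν := ν) (T := Tᶜ) hA hB
  simp only [← sdiff_eq] at h₄
  linarith

/-- The errors of an intersection and a union against `T` add up to those of the two sets. -/
theorem measureReal_inter_symmDiff_add_union_symmDiff (hA : MeasurableSet A)
    (hB : MeasurableSet B) (hT : MeasurableSet T) :
    ν.real ((A ∩ B) ∆ T) + ν.real ((A ∪ B) ∆ T) = ν.real (A ∆ T) + ν.real (B ∆ T) := by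
  have h₁ := measureReal_symmDiff_add_diff_of_subset (ν := ν) (hA.inter hB) (hA.union hB) hT
    (inter_subset_left.trans subset_union_left)
  rw [show (A ∪ B) \ (A ∩ B) = A ∆ B from (symmDiff_eq_sup_sdiff_inf A B).symm] at h₁
  linarith [two_mul_measureReal_inter_symmDiff (ν := ν) hA hB hT]

end MeasureTheory

/-- Let `S₁, S₂, S₁', S₂', S*` be measurable, `Q := S₁ Δ S₂` the
contention region, and assume the non-degradation condition
`μ((S_v' Δ S*) ∖ Q) ≤ μ((S_v Δ S*) ∖ Q)` for `v = 1, 2`. Let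
`D := (S₁' Δ S₂') ∖ Q` with `μ(D) > 0` and `τ := μ(D ∖ S*)/μ(D) − 1/2`. Then
`μ(((S₁' ∩ S₂') Δ S*) ∖ Q) ≤ μ(((S₁ ∩ S₂) Δ S*) ∖ Q) − τ·μ(D)` and
`μ(((S₁' ∪ S₂') Δ S*) ∖ Q) ≤ μ(((S₁ ∪ S₂) Δ S*) ∖ Q) + τ·μ(D)`. -/
theorem non_degradation_contraction_outside_contention
    {X : Type*} [MeasurableSpace X] (μ : Measure X) [IsFiniteMeasure μ]
    (S₁ S₂ S₁' S₂' Sstar : Set X)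
    (hS₁ : MeasurableSet S₁) (hS₂ : MeasurableSet S₂)
    (hS₁' : MeasurableSet S₁') (hS₂' : MeasurableSet S₂')
    (hSstar : MeasurableSet Sstar)
    (Q : Set X) (hQdef : Q = S₁ ∆ S₂)
    (hnd₁ : μ ((S₁' ∆ Sstar) \ Q) ≤ μ ((S₁ ∆ Sstar) \ Q))
    (hnd₂ : μ ((S₂' ∆ Sstar) \ Q) ≤ μ ((S₂ ∆ Sstar) \ Q))
    (D : Set X) (hDdef : D = (S₁' ∆ S₂') \ Q) (hDpos : 0 < (μ D).toReal)
    (τ : ℝ) (hτ : τ = (μ (D \ Sstar)).toReal / (μ D).toReal - 1/2) :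
    (μ (((S₁' ∩ S₂') ∆ Sstar) \ Q)).toReal
        ≤ (μ (((S₁ ∩ S₂) ∆ Sstar) \ Q)).toReal - τ * (μ D).toReal ∧
    (μ (((S₁' ∪ S₂') ∆ Sstar) \ Q)).toReal
        ≤ (μ (((S₁ ∪ S₂) ∆ Sstar) \ Q)).toReal + τ * (μ D).toReal := by
  have hQ : MeasurableSet Q := hQdef ▸ hS₁.symmDiff hS₂
  have off_Q {U : Set X} (hU : MeasurableSet U) : (μ (U \ Q)).toReal = (μ.restrict Qᶜ).real U := by
    rw [measureReal_restrict_apply hU, ← sdiff_eq, measureReal_def]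
  have e_inter : ((S₁ ∩ S₂) ∆ Sstar) \ Q = (S₁ ∆ Sstar) \ Q := by
    ext x
    simp only [hQdef, mem_symmDiff, mem_sdiff, mem_inter_iff]
    tauto
  have e_union : ((S₁ ∪ S₂) ∆ Sstar) \ Q = (S₁ ∆ Sstar) \ Q := by
    ext x
    simp only [hQdef, mem_symmDiff, mem_sdiff, mem_union]
    tauto
  have e_right : (S₂ ∆ Sstar) \ Q = (S₁ ∆ Sstar) \ Q := by
    ext x
    simp only [hQdef, mem_symmDiff, mem_sdiff]
    tauto
  have h₁ := ENNReal.toReal_mono (measure_ne_top _ _) hnd₁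
  have h₂ := ENNReal.toReal_mono (measure_ne_top _ _) hnd₂
  rw [e_right, off_Q (hS₂'.symmDiff hSstar)] at h₂
  rw [off_Q (hS₁'.symmDiff hSstar)] at h₁
  have hD : (μ D).toReal = (μ.restrict Qᶜ).real (S₁' ∆ S₂') := by
    rw [hDdef, off_Q (hS₁'.symmDiff hS₂')]
  have hDS : (μ (D \ Sstar)).toReal = (μ.restrict Qᶜ).real ((S₁' ∆ S₂') \ Sstar) := by
    rw [hDdef, sdiff_sdiff_comm, off_Q ((hS₁'.symmDiff hS₂').diff hSstar)]
  have hτD : τ * (μ D).toReal = (μ (D \ Sstar)).toReal - (μ D).toReal / 2 := by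
    rw [hτ, sub_mul, div_mul_cancel₀ _ hDpos.ne']
    ring
  have h_split := measureReal_inter_add_sdiff (μ := μ.restrict Qᶜ) (s := S₁' ∆ S₂') hSstar
  have h_inter := two_mul_measureReal_inter_symmDiff (ν := μ.restrict Qᶜ) hS₁' hS₂' hSstar
  have h_union :=
    measureReal_inter_symmDiff_add_union_symmDiff (ν := μ.restrict Qᶜ) hS₁' hS₂' hSstar
  rw [hτD, hDS, hD, e_inter, e_union, off_Q ((hS₁'.inter hS₂').symmDiff hSstar),
    off_Q ((hS₁'.union hS₂').symmDiff hSstar)]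
  constructor <;> linarith
end

section
/- Let S₁, S₂, S₁', S₂', S* ⊆ X be measurable, let Q := S₁ Δ S₂ be the contention region, and assume the non-degradation condition μ((S_v' Δ S*) ∖ Q) ≤ μ((S_v Δ S*) ∖ Q) for v = 1, 2. Let D := (S₁' Δ S₂') ∖ Q, assume μ(D) > 0, and set τ := μ(D ∖ S*)/μ(D) − 1/2. If moreover μ(((S₁' ∩ S₂') Δ S*) ∩ Q) ≤ (1/8) μ(Q), then μ((S₁' ∩ S₂') Δ S*) ≤ μ((S₁ ∩ S₂) ∖ S*) + μ(S* ∖ (S₁ ∪ S₂)) + (1/8) μ(Q) − τ · μ(D); and if μ(((S₁' ∪ S₂') Δ S*) ∩ Q) ≤ (1/8) μ(Q), then μ((S₁' ∪ S₂') Δ S*) ≤ μ((S₁ ∩ S₂) ∖ S*) + μ(S* ∖ (S₁ ∪ S₂)) + (1/8) μ(Q) + τ · μ(D). -/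
open MeasureTheory Set
open scoped symmDiff

/-- Off `R`, the errors of `A` and `B` in approximating `T` are, counted with multiplicity, twice the
common error plus the disagreement of `A` and `B`. -/
theorem measureReal_symmDiff_diff_add {X : Type*} [MeasurableSpace X] (μ : Measure X)
    [IsFiniteMeasure μ] {A B T R : Set X} (hA : MeasurableSet A) (hB : MeasurableSet B)
    (hT : MeasurableSet T) (hR : MeasurableSet R) :
    μ.real ((A ∆ T) \ R) + μ.real ((B ∆ T) \ R)
      = 2 * μ.real (((A ∆ T) ∩ (B ∆ T)) \ R) + μ.real ((A ∆ B) \ R) := by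
  have h := measureReal_union_add_inter (μ := μ) (s := (A ∆ T) \ R) ((hB.symmDiff hT).diff hR)
  have hunion : (A ∆ T) \ R ∪ (B ∆ T) \ R = ((A ∆ T) ∩ (B ∆ T)) \ R ∪ (A ∆ B) \ R := by
    ext x; simp only [mem_union, mem_inter_iff, mem_sdiff, mem_symmDiff]; tauto
  have hinter : (A ∆ T) \ R ∩ ((B ∆ T) \ R) = ((A ∆ T) ∩ (B ∆ T)) \ R := by
    ext x; simp only [mem_inter_iff, mem_sdiff]; tauto
  have hdisj : Disjoint (((A ∆ T) ∩ (B ∆ T)) \ R) ((A ∆ B) \ R) := by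
    rw [disjoint_left]; intro x; simp only [mem_inter_iff, mem_sdiff, mem_symmDiff]; tauto
  rw [hunion, hinter, measureReal_union hdisj ((hA.symmDiff hB).diff hR)] at h
  linarith

/-- Off `R`, the intersection `A ∩ B` errs where both sets err or where they disagree on `T`. -/
theorem measureReal_inter_symmDiff_diff_le {X : Type*} [MeasurableSpace X] (μ : Measure X)
    [IsFiniteMeasure μ] (A B T R : Set X) :
    μ.real (((A ∩ B) ∆ T) \ R)
      ≤ μ.real (((A ∆ T) ∩ (B ∆ T)) \ R) + μ.real (((A ∆ B) \ R) ∩ T) := by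
  refine (measureReal_mono ?_).trans (measureReal_union_le _ _)
  intro x; simp only [mem_union, mem_inter_iff, mem_sdiff, mem_symmDiff]; tauto

/-- Off `R`, the union `A ∪ B` errs where both sets err or where they disagree outside `T`. -/
theorem measureReal_union_symmDiff_diff_le {X : Type*} [MeasurableSpace X] (μ : Measure X)
    [IsFiniteMeasure μ] (A B T R : Set X) :
    μ.real (((A ∪ B) ∆ T) \ R)
      ≤ μ.real (((A ∆ T) ∩ (B ∆ T)) \ R) + μ.real (((A ∆ B) \ R) \ T) := by
  refine (measureReal_mono ?_).trans (measureReal_union_le _ _)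
  intro x; simp only [mem_union, mem_inter_iff, mem_sdiff, mem_symmDiff]; tauto

/-- Off `A ∆ B`, the error of `A` in approximating `T` is the common error of `A` and `B`. -/
theorem measureReal_symmDiff_diff_symmDiff_le {X : Type*} [MeasurableSpace X] (μ : Measure X)
    [IsFiniteMeasure μ] (A B T : Set X) :
    μ.real ((A ∆ T) \ (A ∆ B)) ≤ μ.real ((A ∩ B) \ T) + μ.real (T \ (A ∪ B)) := by
  refine (measureReal_mono ?_).trans (measureReal_union_le _ _)
  intro x; simp only [mem_union, mem_inter_iff, mem_sdiff, mem_symmDiff]; tauto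

/-- Under the non-degradation condition, with `Q := S₁ Δ S₂`,
`D := (S₁' Δ S₂') ∖ Q`, `μ(D) > 0` and `τ := μ(D ∖ S*)/μ(D) − 1/2`:
if `μ(((S₁' ∩ S₂') Δ S*) ∩ Q) ≤ (1/8) μ(Q)` then
`μ((S₁' ∩ S₂') Δ S*) ≤ μ((S₁ ∩ S₂) ∖ S*) + μ(S* ∖ (S₁ ∪ S₂)) + (1/8) μ(Q) − τ·μ(D)`;
and if `μ(((S₁' ∪ S₂') Δ S*) ∩ Q) ≤ (1/8) μ(Q)` then
`μ((S₁' ∪ S₂') Δ S*) ≤ μ((S₁ ∩ S₂) ∖ S*) + μ(S* ∖ (S₁ ∪ S₂)) + (1/8) μ(Q) + τ·μ(D)`. -/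
theorem per_round_symmDiff_bound
    {X : Type*} [MeasurableSpace X] (μ : Measure X) [IsFiniteMeasure μ]
    (S₁ S₂ S₁' S₂' Sstar : Set X)
    (hS₁ : MeasurableSet S₁) (hS₂ : MeasurableSet S₂)
    (hS₁' : MeasurableSet S₁') (hS₂' : MeasurableSet S₂')
    (hSstar : MeasurableSet Sstar)
    (Q : Set X) (hQdef : Q = S₁ ∆ S₂)
    (hnd₁ : μ ((S₁' ∆ Sstar) \ Q) ≤ μ ((S₁ ∆ Sstar) \ Q))
    (hnd₂ : μ ((S₂' ∆ Sstar) \ Q) ≤ μ ((S₂ ∆ Sstar) \ Q))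
    (D : Set X) (hDdef : D = (S₁' ∆ S₂') \ Q) (hDpos : 0 < (μ D).toReal)
    (τ : ℝ) (hτ : τ = (μ (D \ Sstar)).toReal / (μ D).toReal - 1/2) :
    ((μ (((S₁' ∩ S₂') ∆ Sstar) ∩ Q)).toReal ≤ (1/8) * (μ Q).toReal →
      (μ ((S₁' ∩ S₂') ∆ Sstar)).toReal
        ≤ (μ ((S₁ ∩ S₂) \ Sstar)).toReal + (μ (Sstar \ (S₁ ∪ S₂))).toReal
          + (1/8) * (μ Q).toReal - τ * (μ D).toReal) ∧
    ((μ (((S₁' ∪ S₂') ∆ Sstar) ∩ Q)).toReal ≤ (1/8) * (μ Q).toReal →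
      (μ ((S₁' ∪ S₂') ∆ Sstar)).toReal
        ≤ (μ ((S₁ ∩ S₂) \ Sstar)).toReal + (μ (Sstar \ (S₁ ∪ S₂))).toReal
          + (1/8) * (μ Q).toReal + τ * (μ D).toReal) := by
  simp only [← measureReal_def] at *
  have hQ : MeasurableSet Q := hQdef ▸ hS₁.symmDiff hS₂
  have hτD : τ * μ.real D = μ.real (D \ Sstar) - μ.real D / 2 := by
    rw [hτ, sub_mul, div_mul_cancel₀ _ hDpos.ne']; ring
  have hsplit : μ.real (D ∩ Sstar) + μ.real (D \ Sstar) = μ.real D :=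
    measureReal_inter_add_sdiff hSstar
  have hle₁ : μ.real ((S₁' ∆ Sstar) \ Q) ≤ μ.real ((S₁ ∆ Sstar) \ Q) :=
    ENNReal.toReal_mono (measure_ne_top μ _) hnd₁
  have hle₂ : μ.real ((S₂' ∆ Sstar) \ Q) ≤ μ.real ((S₂ ∆ Sstar) \ Q) :=
    ENNReal.toReal_mono (measure_ne_top μ _) hnd₂
  have herr₁ := measureReal_symmDiff_diff_symmDiff_le μ S₁ S₂ Sstar
  have herr₂ := measureReal_symmDiff_diff_symmDiff_le μ S₂ S₁ Sstar
  rw [symmDiff_comm S₂ S₁, inter_comm S₂ S₁, union_comm S₂ S₁] at herr₂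
  rw [← hQdef] at herr₁ herr₂
  have hadd := measureReal_symmDiff_diff_add μ hS₁' hS₂' hSstar hQ
  have hinter := measureReal_inter_symmDiff_diff_le μ S₁' S₂' Sstar Q
  have hunion := measureReal_union_symmDiff_diff_le μ S₁' S₂' Sstar Q
  rw [← hDdef] at hadd hinter hunion
  constructor <;> intro hcontention
  · rw [← measureReal_inter_add_sdiff (s := (S₁' ∩ S₂') ∆ Sstar) hQ]
    linarith
  · rw [← measureReal_inter_add_sdiff (s := (S₁' ∪ S₂') ∆ Sstar) hQ]
    linarith
end

section
/- Let α > 0 and let Q, P, Q'', a', b', τ, γ be real numbers satisfying: Q > 0, P ≥ 0, Q ≥ α·P (the α-expansion condition), 0 ≤ Q'' ≤ Q, −1/2 ≤ τ ≤ 1/2, −1/2 ≤ γ ≤ 1/2, a' ≥ 0, b' ≥ 0, a' ≤ P + Q/8 − τ·Q'', and b' ≤ P + Q/8 + τ·Q''. Define a := (1/2 − γ)·Q + P and b := (1/2 + γ)·Q + P. Then a' ≤ ((5α + 8)/(6α + 8))·a or b' ≤ ((5α + 8)/(6α + 8))·b. -/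
/-- The arithmetic core of the per-round contraction in multi-view
active learning. Let `α > 0` and `Q, P, Q'', a', b', τ, γ` be reals with `Q > 0`,
`P ≥ 0`, `Q ≥ α·P`, `0 ≤ Q'' ≤ Q`, `−1/2 ≤ τ ≤ 1/2`, `−1/2 ≤ γ ≤ 1/2`, `a' ≥ 0`,
`b' ≥ 0`, `a' ≤ P + Q/8 − τ·Q''` and `b' ≤ P + Q/8 + τ·Q''`. With
`a := (1/2 − γ)·Q + P` and `b := (1/2 + γ)·Q + P`, either
`a' ≤ ((5α + 8)/(6α + 8))·a` or `b' ≤ ((5α + 8)/(6α + 8))·b`. -/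
theorem per_round_contraction_arith
    (α Q P Q'' a' b' τ γ : ℝ)
    (hα : 0 < α) (hQ : 0 < Q) (hP : 0 ≤ P) (hexp : Q ≥ α * P)
    (hQ''0 : 0 ≤ Q'') (hQ'' : Q'' ≤ Q)
    (hτl : -(1/2) ≤ τ) (hτu : τ ≤ 1/2)
    (hγl : -(1/2) ≤ γ) (hγu : γ ≤ 1/2)
    (ha'0 : 0 ≤ a') (hb'0 : 0 ≤ b')
    (ha' : a' ≤ P + Q/8 - τ * Q'') (hb' : b' ≤ P + Q/8 + τ * Q'') :
    a' ≤ ((5 * α + 8)/(6 * α + 8)) * ((1/2 - γ) * Q + P) ∨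
    b' ≤ ((5 * α + 8)/(6 * α + 8)) * ((1/2 + γ) * Q + P) := by
  by_contra! h
  obtain ⟨ha, hb⟩ := h
  have hsum : (5 * α + 8) / (6 * α + 8) * (Q + 2 * P) < 2 * P + Q / 4 := by linarith
  have hden : 0 < 6 * α + 8 := by positivity
  rw [div_mul_eq_mul_div, div_lt_iff₀ hden] at hsum
  nlinarith [mul_pos hα hQ]
end

section
/- For all measurable sets A, B ⊆ X, R(A ∩ B) − R(A ∪ B) = ν((A Δ B) × {1}) − ν((A Δ B) × {0}). In particular, the risks of the conservative combination h₊ (predicting 1 only where both views predict 1, i.e. the set A ∩ B) and the liberal combination h₋ (predicting 0 only where both views predict 0, i.e. the set A ∪ B) differ exactly by the difference between the probability mass of positively labeled and negatively labeled points in the contention region A Δ B. -/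
open MeasureTheory Set
open scoped symmDiff

/-- Let `ν` be a probability measure on `X × Bool` (labels `1 = true`,
`0 = false`) and, for measurable `S ⊆ X`, let
`R(S) := ν({(x,y) : y = 1 ∧ x ∉ S}) + ν({(x,y) : y = 0 ∧ x ∈ S})`. Then for all
measurable `A, B ⊆ X`,
`R(A ∩ B) − R(A ∪ B) = ν((A Δ B) × {1}) − ν((A Δ B) × {0})`:
the risks of the conservative combination `h₊` (positive region `A ∩ B`) and the
liberal combination `h₋` (positive region `A ∪ B`) differ exactly by the difference
between the mass of positively and negatively labeled points in the contention
region `A Δ B`. -/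
theorem risk_difference_of_combined_classifiers
    {X : Type*} [MeasurableSpace X] (ν : Measure (X × Bool)) [IsProbabilityMeasure ν]
    (A B : Set X) (hA : MeasurableSet A) (hB : MeasurableSet B) :
    ((ν {q : X × Bool | q.2 = true ∧ q.1 ∉ A ∩ B}).toReal
        + (ν {q : X × Bool | q.2 = false ∧ q.1 ∈ A ∩ B}).toReal)
      - ((ν {q : X × Bool | q.2 = true ∧ q.1 ∉ A ∪ B}).toReal
        + (ν {q : X × Bool | q.2 = false ∧ q.1 ∈ A ∪ B}).toReal)
    = (ν ((A ∆ B) ×ˢ ({true} : Set Bool))).toReal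
      - (ν ((A ∆ B) ×ˢ ({false} : Set Bool))).toReal := by
  have h_pos : ν.real {q : X × Bool | q.2 = true ∧ q.1 ∉ A ∩ B}
      = ν.real {q : X × Bool | q.2 = true ∧ q.1 ∉ A ∪ B}
        + ν.real ((A ∆ B) ×ˢ ({true} : Set Bool)) := by
    rw [← measureReal_union _ ((hA.symmDiff hB).prod (measurableSet_singleton true))]
    · congr 1
      ext q
      simp only [mem_ofPred_eq, mem_union, mem_inter_iff, mem_prod, mem_symmDiff,
        mem_singleton_iff]
      tauto
    · rw [Set.disjoint_left]
      rintro q ⟨-, hq⟩ ⟨hq', -⟩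
      exact hq (symmDiff_subset_union hq')
  have h_neg : ν.real {q : X × Bool | q.2 = false ∧ q.1 ∈ A ∪ B}
      = ν.real {q : X × Bool | q.2 = false ∧ q.1 ∈ A ∩ B}
        + ν.real ((A ∆ B) ×ˢ ({false} : Set Bool)) := by
    rw [← measureReal_union _ ((hA.symmDiff hB).prod (measurableSet_singleton false))]
    · congr 1
      ext q
      simp only [mem_ofPred_eq, mem_union, mem_inter_iff, mem_prod, mem_symmDiff,
        mem_singleton_iff]
      tauto
    · rw [Set.disjoint_left]
      rintro q ⟨-, hqA, hqB⟩ ⟨hq' | hq', -⟩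
      · exact hq'.2 hqB
      · exact hq'.2 hqA
  simp only [measureReal_def] at h_pos h_neg
  linarith
end
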